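/- For β ∈ (0,1), there exists a constant C > 0 such that |g_j^{(β)}| ≤ C · j^{−(β+1)} for all j ≥ 1; that is, g_j^{(β)} = O(j^{−(β+1)}) as j → ∞. -/

import Mathlib

/-- Grünwald coefficient `g_j^(s) = ((-1)^j / j!) * s(s-1)⋯(s-j+1)` (with `g_0 = 1`). -/
noncomputable def grunwald (s : ℝ) (j : ℕ) : ℝ :=
  (-1) ^ j / (Nat.factorial j : ℝ) * ∏ i ∈ Finset.range j, (s - i)

theorem grunwald_succ (s : ℝ) (j : ℕ) :
    grunwald s (j + 1) = grunwald s j * ((j - s) / (j + 1)) := by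
  have h : (Nat.factorial j : ℝ) ≠ 0 := by positivity
  have h' : (j : ℝ) + 1 ≠ 0 := by positivity
  simp only [grunwald, Finset.prod_range_succ, Nat.factorial_succ, Nat.cast_mul, Nat.cast_add,
    Nat.cast_one, pow_succ]
  field_simp
  ring

/-- By Bernoulli's inequality, the ratio of consecutive Grünwald coefficients is at most the ratio
of the corresponding powers `j ^ (-(s + 1))`. -/
theorem sub_div_add_one_le_rpow {s : ℝ} (hs : 0 ≤ s) {x : ℝ} (hx : 0 ≤ x) :
    (x - s) / (x + 1) ≤ (x / (x + 1)) ^ (s + 1) := by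
  have hx' : 0 < x + 1 := by positivity
  have hle : (x + 1)⁻¹ ≤ 1 := inv_le_one_of_one_le₀ (by linarith)
  have h := one_add_mul_self_le_rpow_one_add (s := -(x + 1)⁻¹) (by linarith)
    (p := s + 1) (by linarith)
  convert h using 2 <;> field_simp <;> ring

theorem abs_grunwald_le {s : ℝ} (h₀ : 0 ≤ s) (h₁ : s ≤ 1) {j : ℕ} (hj : 1 ≤ j) :
    |grunwald s j| ≤ s * (j : ℝ) ^ (-(s + 1)) := by
  induction j, hj using Nat.le_induction with
  | base => simp [grunwald, abs_of_nonneg h₀]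
  | succ j hj ih =>
    have hj' : (1 : ℝ) ≤ j := by exact_mod_cast hj
    have hj₀ : (0 : ℝ) < j := by linarith
    have hratio : 0 ≤ ((j : ℝ) - s) / (j + 1) := div_nonneg (by linarith) (by linarith)
    rw [grunwald_succ, abs_mul, abs_of_nonneg hratio]
    calc |grunwald s j| * ((j - s) / (j + 1))
        ≤ s * (j : ℝ) ^ (-(s + 1)) * ((j : ℝ) / (j + 1)) ^ (s + 1) := by
          gcongr
          exact sub_div_add_one_le_rpow h₀ hj₀.le
      _ = s * ((j + 1 : ℕ) : ℝ) ^ (-(s + 1)) := by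
          have hpow : (j : ℝ) ^ (s + 1) ≠ 0 := (Real.rpow_pos_of_pos hj₀ _).ne'
          rw [Real.div_rpow hj₀.le (by linarith), Real.rpow_neg hj₀.le,
            Real.rpow_neg (Nat.cast_nonneg _), Nat.cast_succ]
          field_simp

theorem stmt7 (β : ℝ) (hβ : β ∈ Set.Ioo (0 : ℝ) 1) :
    ∃ C : ℝ, 0 < C ∧ ∀ j : ℕ, 1 ≤ j → |grunwald β j| ≤ C * (j : ℝ) ^ (-(β + 1)) :=
  ⟨β, hβ.1, fun _ hj => abs_grunwald_le hβ.1.le hβ.2.le hj⟩
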